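/- Let A be a unital C*-algebra, φ : A → ℂ a positive linear functional, and c ≥ 0 a real number such that every positive x ∈ A satisfies x ≤ c·φ(x)·1. Then every finite family x₁, …, x_n of positive elements of A with ‖x_i‖ = 1 for all i and x₁ + ⋯ + x_n ≤ 1 satisfies n ≤ c·φ(1); consequently A is finite-dimensional as a complex vector space. -/

import Mathlib

open scoped ComplexOrder

/-- A minimal star projection: a nonzero star projection `p` such that the only star projections
`q` below `p` are `0` and `p`. -/
structure IsMinimalStarProjection {A : Type*} [Mul A] [Star A] [Zero A] (p : A) : Prop where
  isStarProjection : IsStarProjection p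
  ne_zero : p ≠ 0
  eq_zero_or_eq : ∀ q : A, IsStarProjection q → p * q = q → q = 0 ∨ q = p

lemma one_le_norm_of_isStarProjection {A : Type*} [CStarAlgebra A] {p : A}
    (hp : IsStarProjection p) (h0 : p ≠ 0) : 1 ≤ ‖p‖ := by
  have h := CStarRing.norm_star_mul_self (x := p)
  rw [hp.isSelfAdjoint.star_eq, hp.isIdempotentElem.eq] at h
  have := norm_pos_iff.mpr h0
  nlinarith

/-- If an additive functional dominates the norm on positive elements, then the number of
points in the real spectrum of a self-adjoint element is at most its value at `1`. -/
lemma card_le_of_subset_spectrum {A : Type*} [CStarAlgebra A] [PartialOrder A] [StarOrderedRing A]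
    (τ : A →+ ℝ) (hτ : ∀ x : A, 0 ≤ x → ‖x‖ ≤ τ x) {y : A} (hy : IsSelfAdjoint y)
    {t : Finset ℝ} (ht : (t : Set ℝ) ⊆ spectrum ℝ y) : (t.card : ℝ) ≤ τ 1 := by
  classical
  rcases t.eq_empty_or_nonempty with rfl | hne
  · have := (norm_nonneg _).trans (hτ (star 1 * 1) (star_mul_self_nonneg _))
    simpa using this
  let d : ℝ → ℝ → ℝ := fun i x ↦ ∏ j ∈ t.erase i, |x - j|
  have d_nonneg : ∀ i x, 0 ≤ d i x := fun i x ↦ Finset.prod_nonneg fun _ _ ↦ abs_nonneg _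
  have d_cont : ∀ i, Continuous (d i) := fun i ↦ by fun_prop
  have d_self : ∀ i, 0 < d i i := fun i ↦ Finset.prod_pos fun j hj ↦
    abs_pos.mpr (sub_ne_zero.mpr (Finset.ne_of_mem_erase hj).symm)
  have d_ne : ∀ i ∈ t, ∀ j, i ≠ j → d j i = 0 := fun i hi j hij ↦
    Finset.prod_eq_zero (Finset.mem_erase.mpr ⟨hij, hi⟩) (by simp)
  let D : ℝ → ℝ := fun x ↦ ∑ i ∈ t, d i x
  have D_pos : ∀ x, 0 < D x := by
    intro x
    by_cases hx : x ∈ t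
    · exact (d_self x).trans_le (Finset.single_le_sum (fun i _ ↦ d_nonneg i x) hx)
    · exact Finset.sum_pos (fun i _ ↦ Finset.prod_pos fun j hj ↦ abs_pos.mpr <|
        sub_ne_zero.mpr fun h ↦ hx (h ▸ Finset.mem_of_mem_erase hj)) hne
  have D_cont : Continuous D := continuous_finsetSum _ fun i _ ↦ d_cont i
  let f : ℝ → ℝ → ℝ := fun i x ↦ d i x / D x
  have f_cont : ∀ i, Continuous (f i) := fun i ↦ (d_cont i).div D_cont fun x ↦ (D_pos x).ne'
  have f_self : ∀ i ∈ t, f i i = 1 := by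
    intro i hi
    have : D i = d i i := Finset.sum_eq_single_of_mem i hi fun j _ hj ↦ d_ne i hi j hj.symm
    simp only [f, this]
    exact div_self (d_self i).ne'
  have f_sum : ∑ i ∈ t, f i = fun _ ↦ 1 := by
    funext x
    rw [Finset.sum_apply]
    simp only [f, ← Finset.sum_div]
    exact div_self (D_pos x).ne'
  have h1 : (1 : A) = ∑ i ∈ t, cfc (f i) y := by
    rw [← cfc_sum f y t fun i _ ↦ (f_cont i).continuousOn, f_sum, cfc_const_one ℝ y]
  rw [h1, map_sum, Finset.card_eq_sum_ones, Nat.cast_sum]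
  refine Finset.sum_le_sum fun i hi ↦ ?_
  have h2 := norm_apply_le_norm_cfc (f i) y (ht hi) (f_cont i).continuousOn hy
  rw [f_self i hi, norm_one] at h2
  simpa using h2.trans (hτ _ (cfc_nonneg fun x _ ↦ div_nonneg (d_nonneg i x) (D_pos x).le))

lemma finite_spectrum_of_norm_le {A : Type*} [CStarAlgebra A] [PartialOrder A] [StarOrderedRing A]
    (τ : A →+ ℝ) (hτ : ∀ x : A, 0 ≤ x → ‖x‖ ≤ τ x) {y : A} (hy : IsSelfAdjoint y) :
    (spectrum ℝ y).Finite := by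
  by_contra hinf
  obtain ⟨n, hn⟩ := exists_nat_gt (τ 1)
  obtain ⟨t, ht, rfl⟩ := Set.Infinite.exists_subset_card_eq hinf n
  exact hn.not_ge (card_le_of_subset_spectrum τ hτ hy ht)

/-- A self-adjoint element with finite spectrum is a real linear combination of star projections
commuting with everything the element commutes with. -/
lemma exists_eq_sum_smul_isStarProjection {A : Type*} [CStarAlgebra A] {y : A}
    (hy : IsSelfAdjoint y) (hfin : (spectrum ℝ y).Finite) :
    ∃ (s : Finset ℝ) (q : ℝ → A), (∀ i, IsStarProjection (q i)) ∧
      (∀ i b, Commute y b → Commute (q i) b) ∧ y = ∑ i ∈ s, i • q i := by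
  classical
  let f : ℝ → ℝ → ℝ := fun i x ↦ if x = i then 1 else 0
  have hc : ∀ g : ℝ → ℝ, ContinuousOn g (spectrum ℝ y) := fun g ↦ hfin.continuousOn g
  refine ⟨hfin.toFinset, fun i ↦ cfc (f i) y, fun i ↦ ⟨?_, cfc_predicate _ _⟩,
    fun i b hb ↦ hb.cfc_real _, ?_⟩
  · rw [IsIdempotentElem, ← cfc_mul (f i) (f i) y (hc _) (hc _)]
    congr 1
    funext x
    simp [f]
  · simp_rw [← fun i : ℝ ↦ cfc_smul i (f i) y (hc _)]
    rw [← cfc_sum (fun i x ↦ i • f i x) y _ fun i _ ↦ hc _]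
    conv_lhs => rw [← cfc_id ℝ y]
    refine cfc_congr fun x hx ↦ ?_
    simp [f, hx]

lemma IsMinimalStarProjection.exists_eq_smul {A : Type*} [CStarAlgebra A] {p y : A}
    (hp : IsMinimalStarProjection p) (hfin : ∀ a : A, IsSelfAdjoint a → (spectrum ℝ a).Finite)
    (hpy : p * y = y) (hyp : y * p = y) : ∃ z : ℂ, y = z • p := by
  have key : ∀ a : A, IsSelfAdjoint a → p * a = a → a * p = a → ∃ r : ℝ, a = r • p := by
    intro a ha hpa hap
    obtain ⟨s, q, hq, hcomm, hsum⟩ := exists_eq_sum_smul_isStarProjection ha (hfin a ha)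
    have hqp : ∀ i, Commute p (q i) := fun i ↦ (hcomm i p (hap.trans hpa.symm)).symm
    have hε : ∀ i, ∃ e : ℝ, p * q i = e • p := by
      intro i
      rcases hp.eq_zero_or_eq (p * q i) (hp.isStarProjection.mul (hq i) (hqp i))
        (by rw [← mul_assoc, hp.isStarProjection.isIdempotentElem.eq]) with h | h
      · exact ⟨0, by simpa using h⟩
      · exact ⟨1, by simpa using h⟩
    choose e he using hε
    refine ⟨∑ i ∈ s, i * e i, ?_⟩
    rw [← hpa, hsum, Finset.mul_sum, Finset.sum_smul]
    refine Finset.sum_congr rfl fun i _ ↦ ?_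
    rw [mul_smul_comm, he, smul_smul]
  have hps := hp.isStarProjection.isSelfAdjoint.star_eq
  have hpy' : star y * p = star y := by simpa [hps] using congr(star $hpy)
  have hyp' : p * star y = star y := by simpa [hps] using congr(star $hyp)
  obtain ⟨r, hr⟩ := key (realPart y) (realPart y).2
    (by simp only [realPart_apply_coe, mul_smul_comm, mul_add, hpy, hyp'])
    (by simp only [realPart_apply_coe, smul_mul_assoc, add_mul, hpy', hyp])
  obtain ⟨s, hs⟩ := key (imaginaryPart y) (imaginaryPart y).2
    (by simp only [imaginaryPart_apply_coe, mul_smul_comm, mul_sub, hpy, hyp'])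
    (by simp only [imaginaryPart_apply_coe, smul_mul_assoc, sub_mul, hpy', hyp])
  refine ⟨r + Complex.I * s, ?_⟩
  rw [← realPart_add_I_smul_imaginaryPart y, hr, hs, add_smul, mul_smul]
  simp

/-- For minimal star projections `p` and `q` the corner `p A q` is at most one-dimensional. -/
lemma IsMinimalStarProjection.finiteDimensional_range {A : Type*} [CStarAlgebra A] {p q : A}
    (hp : IsMinimalStarProjection p) (hq : IsMinimalStarProjection q)
    (hfin : ∀ a : A, IsSelfAdjoint a → (spectrum ℝ a).Finite) :
    FiniteDimensional ℂ (LinearMap.mulLeftRight ℂ (p, q)).range := by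
  by_cases h : ∀ a : A, p * a * q = 0
  · have : LinearMap.mulLeftRight ℂ (p, q) = 0 := by
      ext a
      simpa using h a
    rw [this, LinearMap.range_zero]
    infer_instance
  push Not at h
  obtain ⟨a, ha⟩ := h
  have hpp := hp.isStarProjection.isIdempotentElem.eq
  have hqq := hq.isStarProjection.isIdempotentElem.eq
  have hps := hp.isStarProjection.isSelfAdjoint.star_eq
  have hqs := hq.isStarProjection.isSelfAdjoint.star_eq
  set v := p * a * q with hv
  have hpv : p * v = v := by rw [hv, ← mul_assoc, ← mul_assoc, hpp]
  have hvq : v * q = v := by rw [hv, mul_assoc, hqq]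
  have hqv : q * star v = star v := by simpa [hqs] using congr(star $hvq)
  have hvp : star v * p = star v := by simpa [hps] using congr(star $hpv)
  obtain ⟨z, hz⟩ := hq.exists_eq_smul hfin (y := star v * v)
    (by rw [← mul_assoc, hqv]) (by rw [mul_assoc, hvq])
  have hz0 : z ≠ 0 := by
    rintro rfl
    rw [zero_smul, CStarRing.star_mul_self_eq_zero_iff] at hz
    exact ha hz
  refine Submodule.finiteDimensional_of_le (S₂ := Submodule.span ℂ {v}) ?_
  rintro _ ⟨b, rfl⟩
  rw [LinearMap.mulLeftRight_apply]
  obtain ⟨w, hw⟩ := hp.exists_eq_smul hfin (y := p * b * q * star v)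
    (by simp only [← mul_assoc, hpp]) (by rw [mul_assoc, hvp])
  refine Submodule.mem_span_singleton.mpr ⟨z⁻¹ * w, ?_⟩
  have h1 : w • v = z • (p * b * q) := by
    calc w • v = p * b * q * star v * v := by rw [hw, smul_mul_assoc, hpv]
      _ = p * b * q * (star v * v) := mul_assoc _ _ _
      _ = z • (p * b * q) := by rw [hz, mul_smul_comm, mul_assoc _ q q, hqq]
  rw [mul_smul, h1, smul_smul, inv_mul_cancel₀ hz0, one_smul]

/-- If an additive functional dominates the norm on positive elements, then every star projection
is a sum of minimal ones. -/
lemma IsStarProjection.mem_closure_isMinimalStarProjection {A : Type*} [CStarAlgebra A]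
    [PartialOrder A] [StarOrderedRing A] (τ : A →+ ℝ) (hτ : ∀ x : A, 0 ≤ x → ‖x‖ ≤ τ x)
    {p : A} (hp : IsStarProjection p) :
    p ∈ AddSubmonoid.closure {q : A | IsMinimalStarProjection q} := by
  have one_le : ∀ q : A, IsStarProjection q → q ≠ 0 → 1 ≤ τ q := fun q hq h0 ↦
    (one_le_norm_of_isStarProjection hq h0).trans (hτ q hq.nonneg)
  obtain ⟨n, hn⟩ := exists_nat_gt (τ p)
  induction n generalizing p with
  | zero =>
    have := (norm_nonneg p).trans (hτ p hp.nonneg)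
    norm_num at hn
    linarith
  | succ n ih =>
    by_cases h0 : p = 0
    · exact h0 ▸ zero_mem _
    by_cases hmin : IsMinimalStarProjection p
    · exact AddSubmonoid.subset_closure hmin
    obtain ⟨q, hq, hpq, hq0, hqp⟩ : ∃ q : A, IsStarProjection q ∧ p * q = q ∧ q ≠ 0 ∧ q ≠ p := by
      by_contra! hcon
      exact hmin ⟨hp, h0, fun q hq hpq ↦ or_iff_not_imp_left.mpr (hcon q hq hpq)⟩
    have hr : IsStarProjection (p - q) := hq.sub_of_mul_eq_right hp hpq
    have h1 := one_le q hq hq0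
    have h2 := one_le (p - q) hr (sub_ne_zero.mpr hqp.symm)
    have h3 : τ (p - q) = τ p - τ q := map_sub τ p q
    push_cast at hn
    rw [← add_sub_cancel q p]
    exact add_mem (ih hq (by linarith)) (ih hr (by linarith))

/-- A unital C⋆-algebra with an additive functional dominating the norm on positive elements is
finite-dimensional. -/
lemma finiteDimensional_of_norm_le {A : Type*} [CStarAlgebra A] [PartialOrder A]
    [StarOrderedRing A] (τ : A →+ ℝ) (hτ : ∀ x : A, 0 ≤ x → ‖x‖ ≤ τ x) :
    FiniteDimensional ℂ A := by
  have hfin : ∀ a : A, IsSelfAdjoint a → (spectrum ℝ a).Finite :=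
    fun a ha ↦ finite_spectrum_of_norm_le τ hτ ha
  have h1 := IsStarProjection.mem_closure_isMinimalStarProjection τ hτ (IsStarProjection.one A)
  have key : FiniteDimensional ℂ (LinearMap.mulLeftRight ℂ ((1 : A), (1 : A))).range := by
    refine AddSubmonoid.closure_induction₂
      (motive := fun p q _ _ ↦ FiniteDimensional ℂ (LinearMap.mulLeftRight ℂ (p, q)).range)
      (fun p q hp hq ↦ hp.finiteDimensional_range hq hfin) ?_ ?_ ?_ ?_ h1 h1
    · intro q _
      have : LinearMap.mulLeftRight ℂ ((0 : A), q) = 0 := by ext; simp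
      rw [this, LinearMap.range_zero]
      infer_instance
    · intro q _
      have : LinearMap.mulLeftRight ℂ (q, (0 : A)) = 0 := by ext; simp
      rw [this, LinearMap.range_zero]
      infer_instance
    · intro p q r _ _ _ _ _
      have : LinearMap.mulLeftRight ℂ (p + q, r) =
          LinearMap.mulLeftRight ℂ (p, r) + LinearMap.mulLeftRight ℂ (q, r) := by
        ext; simp [add_mul]
      rw [this]
      exact Submodule.finiteDimensional_of_le (LinearMap.range_add_le _ _)
    · intro p q r _ _ _ _ _
      have : LinearMap.mulLeftRight ℂ (r, p + q) =
          LinearMap.mulLeftRight ℂ (r, p) + LinearMap.mulLeftRight ℂ (r, q) := by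
        ext; simp [mul_add]
      rw [this]
      exact Submodule.finiteDimensional_of_le (LinearMap.range_add_le _ _)
  have htop : (LinearMap.mulLeftRight ℂ ((1 : A), (1 : A))).range = ⊤ :=
    LinearMap.range_eq_top.mpr fun a ↦ ⟨a, by simp⟩
  rw [htop] at key
  exact Module.finite_def.mpr (Module.Finite.iff_fg.mp key)

/-- Let `φ` be a positive linear functional on a unital C*-algebra `A` and `c ≥ 0` a
real number such that every positive `x ∈ A` satisfies `x ≤ c·φ(x)·1`. Then every
finite family of positive norm-one elements whose sum is ≤ 1 has at most `c·φ(1)`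
members, and `A` is finite-dimensional over `ℂ`. -/
theorem stmt3 {A : Type*} [CStarAlgebra A] [PartialOrder A] [StarOrderedRing A]
    (φ : A →ₗ[ℂ] ℂ) (hφ : ∀ x : A, 0 ≤ x → 0 ≤ φ x)
    (c : ℝ) (hc : 0 ≤ c)
    (hbound : ∀ x : A, 0 ≤ x → x ≤ ((c : ℂ) * φ x) • (1 : A)) :
    (∀ (n : ℕ) (x : Fin n → A), (∀ i, 0 ≤ x i) → (∀ i, ‖x i‖ = 1) →
      (∑ i, x i) ≤ 1 → (n : ℂ) ≤ (c : ℂ) * φ 1) ∧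
    FiniteDimensional ℂ A := by
  let τ : A →+ ℝ := (AddMonoidHom.mulLeft c).comp (Complex.reAddGroupHom.comp φ.toAddMonoidHom)
  have τ_apply : ∀ x, τ x = c * (φ x).re := fun _ ↦ rfl
  have τ_coe : ∀ x, 0 ≤ x → (c : ℂ) * φ x = (τ x : ℂ) := by
    intro x hx
    rw [τ_apply, Complex.ofReal_mul, ← Complex.eq_re_of_ofReal_le (r := 0) (by simpa using hφ x hx)]
  have τ_nonneg : ∀ x, 0 ≤ x → 0 ≤ τ x := fun x hx ↦
    mul_nonneg hc (Complex.nonneg_iff.mp (hφ x hx)).1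
  have hτ : ∀ x : A, 0 ≤ x → ‖x‖ ≤ τ x := by
    intro x hx
    rcases subsingleton_or_nontrivial A with _ | _
    · rw [Subsingleton.elim x 0]
      simp
    have h := CStarAlgebra.norm_le_norm_of_nonneg_of_le hx (hbound x hx)
    rwa [τ_coe x hx, norm_smul, norm_one, mul_one, Complex.norm_real,
      Real.norm_of_nonneg (τ_nonneg x hx)] at h
  refine ⟨fun n x hx hx1 hsum ↦ ?_, finiteDimensional_of_norm_le τ hτ⟩
  have h1 : (0 : A) ≤ 1 := (IsStarProjection.one A).nonneg
  rw [τ_coe 1 h1]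
  have h2 : (n : ℝ) ≤ τ (∑ i, x i) := by
    rw [map_sum]
    calc (n : ℝ) = ∑ i : Fin n, (1 : ℝ) := by simp
      _ ≤ ∑ i, τ (x i) := Finset.sum_le_sum fun i _ ↦ hx1 i ▸ hτ (x i) (hx i)
  have h3 := τ_nonneg _ (sub_nonneg.mpr hsum)
  rw [map_sub] at h3
  exact_mod_cast h2.trans (sub_nonneg.mp h3)
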